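/- Let n ≥ 1, let e ∈ ℝⁿ satisfy e(i) − e(j) ∉ ℤ for all 1 ≤ i < j ≤ n, and let v, v' ∈ ℝⁿ satisfy v + e ∈ ℤⁿ, v' + e ∈ ℤⁿ and ⟨v⟩ = ⟨v'⟩. If δ(v) ≤ δ(v'), then δ(ς(v)) ≤ δ(ς(v')). -/

import Mathlib

/-- `vmin v` is `min[v]`, the minimum of the coordinates of `v`. -/
noncomputable def vmin {n : ℕ} (v : Fin n → ℝ) : ℝ := ⨅ i, v i

/-- `vmax v` is `max[v]`, the maximum of the coordinates of `v`. -/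
noncomputable def vmax {n : ℕ} (v : Fin n → ℝ) : ℝ := ⨆ i, v i

/-- `vdelta v = ⟨v⟩ - n · min[v]`. -/
noncomputable def vdelta {n : ℕ} (v : Fin n → ℝ) : ℝ := (∑ i, v i) - n * vmin v

/-- `vh v = Σ_i ⌊v(i) - min[v]⌋`. -/
noncomputable def vh {n : ℕ} (v : Fin n → ℝ) : ℤ := ∑ i, ⌊v i - vmin v⌋

/-- `vsig v = ς(v)`, subtracting 1 from every maximal coordinate of `v`. -/
noncomputable def vsig {n : ℕ} (v : Fin n → ℝ) : Fin n → ℝ :=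
  fun i => if v i = vmax v then v i - 1 else v i

theorem vmin_le {n : ℕ} (v : Fin n → ℝ) (i : Fin n) : vmin v ≤ v i :=
  ciInf_le (Set.finite_range v).bddBelow i

theorem le_vmax {n : ℕ} (v : Fin n → ℝ) (i : Fin n) : v i ≤ vmax v :=
  le_ciSup (Set.finite_range v).bddAbove i

theorem vsig_le {n : ℕ} (v : Fin n → ℝ) (i : Fin n) : vsig v i ≤ v i := by
  unfold vsig
  split_ifs <;> linarith

/-- If the coordinates of `v` are distinct, then `ς` lowers exactly one coordinate. -/
theorem sum_vsig {n : ℕ} (hn : 1 ≤ n) (v : Fin n → ℝ) (hv : Function.Injective v) :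
    ∑ i, vsig v i = ∑ i, v i - 1 := by
  have : Nonempty (Fin n) := ⟨⟨0, hn⟩⟩
  obtain ⟨m, hm⟩ := exists_eq_ciSup_of_finite (f := v)
  have key : ∀ i, vsig v i = v i - if i = m then 1 else 0 := by
    intro i
    have hi : v i = vmax v ↔ i = m := by
      unfold vmax
      rw [← hm, hv.eq_iff]
    simp only [vsig, hi]
    split_ifs <;> simp
  simp [key, Finset.sum_sub_distrib]

/-- Coordinates are distinct as soon as those of `e` are distinct modulo `ℤ`. -/
theorem injective_of_add_int {n : ℕ} {e v : Fin n → ℝ}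
    (he : ∀ i j : Fin n, i < j → ¬ ∃ z : ℤ, e i - e j = (z : ℝ))
    (hv : ∀ i, ∃ z : ℤ, v i + e i = (z : ℝ)) : Function.Injective v := by
  refine Function.Injective.of_lt_imp_ne fun i j hij h => he i j hij ?_
  obtain ⟨a, ha⟩ := hv i
  obtain ⟨b, hb⟩ := hv j
  exact ⟨a - b, by push_cast; linarith⟩

/-- If `v` and `v'` agree modulo `ℤⁿ` and have equal sums, then `ς(v')` has a coordinate that is
at most `max[v] - 1`. -/
theorem exists_vsig_le {n : ℕ} (hn : 1 ≤ n) {v v' : Fin n → ℝ}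
    (hvv' : ∀ i, ∃ z : ℤ, v' i - v i = (z : ℝ)) (hsum : ∑ i, v i = ∑ i, v' i) :
    ∃ j, vsig v' j ≤ vmax v - 1 := by
  have : Nonempty (Fin n) := ⟨⟨0, hn⟩⟩
  by_contra! hlt
  have hle : ∀ j ∈ Finset.univ, v j ≤ v' j := by
    intro j _
    obtain ⟨z, hz⟩ := hvv' j
    have hz1 : (-1 : ℝ) < z := by linarith [hlt j, vsig_le v' j, le_vmax v j]
    have hz0 : (0 : ℤ) ≤ z := by
      have : (-1 : ℤ) < z := by exact_mod_cast hz1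
      omega
    have : (0 : ℝ) ≤ z := by exact_mod_cast hz0
    linarith
  obtain rfl : v = v' :=
    funext fun j => (Finset.sum_eq_sum_iff_of_le hle).1 hsum j (Finset.mem_univ j)
  obtain ⟨m, hm⟩ := exists_eq_ciSup_of_finite (f := v)
  have hm' : v m = vmax v := hm
  have := hlt m
  simp [vsig, hm'] at this

theorem stmt_4 {n : ℕ} (hn : 1 ≤ n) (e v v' : Fin n → ℝ)
    (he : ∀ i j : Fin n, i < j → ¬ ∃ z : ℤ, e i - e j = (z : ℝ))
    (hv : ∀ i, ∃ z : ℤ, v i + e i = (z : ℝ))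
    (hv' : ∀ i, ∃ z : ℤ, v' i + e i = (z : ℝ))
    (hsum : ∑ i, v i = ∑ i, v' i)
    (hd : vdelta v ≤ vdelta v') :
    vdelta (vsig v) ≤ vdelta (vsig v') := by
  have : Nonempty (Fin n) := ⟨⟨0, hn⟩⟩
  have hmin : vmin v' ≤ vmin v := by
    have hn' : (0 : ℝ) < n := by exact_mod_cast hn
    unfold vdelta at hd
    exact le_of_mul_le_mul_left (by linarith) hn'
  have hvv' : ∀ i, ∃ z : ℤ, v' i - v i = (z : ℝ) := by
    intro i
    obtain ⟨a, ha⟩ := hv i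
    obtain ⟨b, hb⟩ := hv' i
    exact ⟨b - a, by push_cast; linarith⟩
  have hsig : vmin (vsig v') ≤ vmin (vsig v) := by
    refine le_ciInf fun k => ?_
    by_cases hk : v k = vmax v
    · obtain ⟨j, hj⟩ := exists_vsig_le hn hvv' hsum
      have hvk : vsig v k = vmax v - 1 := by simp [vsig, hk]
      exact hvk ▸ (vmin_le _ j).trans hj
    · obtain ⟨j, hj⟩ := exists_eq_ciInf_of_finite (f := v')
      have hvk : vsig v k = v k := by simp [vsig, hk]
      have hj' : v' j = vmin v' := hj
      linarith [vmin_le (vsig v') j, vsig_le v' j, vmin_le v k]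
  unfold vdelta
  rw [sum_vsig hn v (injective_of_add_int he hv), sum_vsig hn v' (injective_of_add_int he hv'),
    hsum]
  gcongr
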